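/- Let L be a Lagrangian subspace of V = ℝ^{2n_A} × ℝ^{2n_B} with the product symplectic form. Then there exist natural numbers r, s, E with r + s + 2E = n_A + n_B, vectors a_1,…,a_r ∈ ℝ^{2n_A}, b_1,…,b_s ∈ ℝ^{2n_B}, and vectors u_1,…,u_E, ū_1,…,ū_E ∈ V, writing u_k = (u_k^A, u_k^B) and ū_k = (ū_k^A, ū_k^B), such that the family {(a_i, 0)} ∪ {(0, b_j)} ∪ {u_k} ∪ {ū_k} is a basis of L, and: σ_A(u_k^A, ū_{k'}^A) = −σ_B(u_k^B, ū_{k'}^B) for all k, k', this common value is nonzero when k = k' and zero when k ≠ k', and σ_A(u_k^A, u_{k'}^A) = 0 and σ_A(ū_k^A, ū_{k'}^A) = 0 for all k, k'. -/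

import Mathlib

open scoped BigOperators

namespace EntTrim

/-- The standard symplectic form on `ℝ^(2m)`:
`σ(v, w) = Σ_{i=1}^m (v_{2i-1} * w_{2i} - v_{2i} * w_{2i-1})` (zero-based indexing). -/
def stdSymp (m : ℕ) (v w : Fin (2 * m) → ℝ) : ℝ :=
  ∑ i : Fin m,
    (v ⟨2 * (i : ℕ), by have := i.isLt; omega⟩ *
        w ⟨2 * (i : ℕ) + 1, by have := i.isLt; omega⟩ -
      v ⟨2 * (i : ℕ) + 1, by have := i.isLt; omega⟩ *
        w ⟨2 * (i : ℕ), by have := i.isLt; omega⟩)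

/-- The product symplectic form on `ℝ^(2nA) × ℝ^(2nB)`:
`σ((u_A,u_B),(w_A,w_B)) = σ_A(u_A,w_A) + σ_B(u_B,w_B)`. -/
def prodSymp (nA nB : ℕ) (u w : (Fin (2 * nA) → ℝ) × (Fin (2 * nB) → ℝ)) : ℝ :=
  stdSymp nA u.1 w.1 + stdSymp nB u.2 w.2

section AlternatingForm

variable {K V : Type*} [Field K] [AddCommGroup V] [Module K V]

/-- Two families `u`, `v` indexed by the same finite type form a symplectic family for `ω` when
they are dual to each other and each of them spans an isotropic subspace. -/
structure IsSymplecticFamily (ω : LinearMap.BilinForm K V) {ι : Type*} [DecidableEq ι]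
    (u v : ι → V) : Prop where
  left_left : ∀ i j, ω (u i) (u j) = 0
  right_right : ∀ i j, ω (v i) (v j) = 0
  left_right : ∀ i j, ω (u i) (v j) = if i = j then 1 else 0

variable {ω : LinearMap.BilinForm K V}

theorem IsSymplecticFamily.right_left {ι : Type*} [DecidableEq ι] {u v : ι → V}
    (h : IsSymplecticFamily ω u v) (hω : ω.IsAlt) (i j : ι) :
    ω (v i) (u j) = if i = j then -1 else 0 := by
  rw [← hω.neg_eq, h.left_right]
  split_ifs <;> simp_all

/-- A symplectic family extends any linearly independent family orthogonal to it. -/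
theorem IsSymplecticFamily.linearIndependent_sumElim {ι κ : Type*} [DecidableEq ι] [Fintype ι]
    [Fintype κ] {u v : ι → V} (h : IsSymplecticFamily ω u v) (hω : ω.IsAlt) {c : κ → V}
    (hc : LinearIndependent K c) (hcu : ∀ k i, ω (c k) (u i) = 0)
    (hcv : ∀ k i, ω (c k) (v i) = 0) :
    LinearIndependent K (Sum.elim c (Sum.elim u v)) := by
  rw [Fintype.linearIndependent_iff]
  intro g hg
  simp only [Fintype.sum_sum_type, Sum.elim_inl, Sum.elim_inr] at hg
  have hu : ∀ i, g (.inr (.inl i)) = 0 := by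
    intro i
    have := congrArg (fun x => ω x (v i)) hg
    simpa [LinearMap.sum_apply, hcv, h.right_right, h.left_right] using this
  have hv : ∀ i, g (.inr (.inr i)) = 0 := by
    intro i
    have := congrArg (fun x => ω x (u i)) hg
    simpa [LinearMap.sum_apply, hcu, h.left_left, h.right_left hω] using this
  have hc' : ∀ k, g (.inl k) = 0 := by
    refine Fintype.linearIndependent_iff.1 hc (fun k => g (.inl k)) ?_
    simpa [hu, hv] using hg
  rintro (k | i | i)
  exacts [hc' k, hu i, hv i]

/-- The component of `w` that is `ω`-orthogonal to a symplectic family `u`, `v`. -/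
def symplecticResidue (ω : LinearMap.BilinForm K V) {ι : Type*} [Fintype ι] (u v : ι → V)
    (w : V) : V :=
  w - (∑ i, ω w (v i) • u i - ∑ i, ω w (u i) • v i)

theorem IsSymplecticFamily.symplecticResidue_left {ι : Type*} [DecidableEq ι] [Fintype ι]
    {u v : ι → V} (h : IsSymplecticFamily ω u v) (hω : ω.IsAlt) (w : V) (i : ι) :
    ω (symplecticResidue ω u v w) (u i) = 0 := by
  simp [symplecticResidue, LinearMap.sum_apply, h.left_left, h.right_left hω]

theorem IsSymplecticFamily.symplecticResidue_right {ι : Type*} [DecidableEq ι] [Fintype ι]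
    {u v : ι → V} (h : IsSymplecticFamily ω u v) (w : V) (i : ι) :
    ω (symplecticResidue ω u v w) (v i) = 0 := by
  simp [symplecticResidue, LinearMap.sum_apply, h.right_right, h.left_right]

theorem symplecticResidue_mem {ι : Type*} [Fintype ι] {u v : ι → V} {W : Submodule K V}
    (hu : ∀ i, u i ∈ W) (hv : ∀ i, v i ∈ W) {w : V} (hw : w ∈ W) :
    symplecticResidue ω u v w ∈ W :=
  W.sub_mem hw (W.sub_mem (W.sum_mem fun i _ => W.smul_mem _ (hu i))
    (W.sum_mem fun i _ => W.smul_mem _ (hv i)))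

theorem IsSymplecticFamily.cons {E : ℕ} {u v : Fin E → V} (h : IsSymplecticFamily ω u v)
    (hω : ω.IsAlt) {x y : V} (hxy : ω x y = 1) (hxu : ∀ i, ω x (u i) = 0)
    (hxv : ∀ i, ω x (v i) = 0) (hyu : ∀ i, ω y (u i) = 0) (hyv : ∀ i, ω y (v i) = 0) :
    IsSymplecticFamily ω (Fin.cons x u : Fin (E + 1) → V) (Fin.cons y v) := by
  have swap : ∀ {a b : V}, ω a b = 0 → ω b a = 0 := fun {a b} hab => hω.isRefl a b hab
  refine ⟨fun i j => ?_, fun i j => ?_, fun i j => ?_⟩ <;>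
    refine Fin.cases ?_ (fun i => ?_) i <;> refine Fin.cases ?_ (fun j => ?_) j
  · simpa using hω.self_eq_zero x
  · simpa using hxu j
  · simpa using swap (hxu i)
  · simpa using h.left_left i j
  · simpa using hω.self_eq_zero y
  · simpa using hyv j
  · simpa using swap (hyv i)
  · simpa using h.right_right i j
  · simpa using hxy
  · simpa [(Fin.succ_ne_zero j).symm] using hxv j
  · simpa [Fin.succ_ne_zero i] using swap (hyu i)
  · simpa using h.left_right i j

/-- Every subspace contains a symplectic family which, together with the radical of the
restricted form, spans the subspace. -/
theorem exists_isSymplecticFamily_residue_mem_radical [FiniteDimensional K V] (hω : ω.IsAlt)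
    (W : Submodule K V) :
    ∃ (E : ℕ) (u v : Fin E → V), IsSymplecticFamily ω u v ∧ (∀ i, u i ∈ W) ∧ (∀ i, v i ∈ W) ∧
      ∀ w ∈ W, ∀ w' ∈ W, ω (symplecticResidue ω u v w) w' = 0 := by
  let P : ℕ → Prop := fun E => ∃ u v : Fin E → V,
    IsSymplecticFamily ω u v ∧ (∀ i, u i ∈ W) ∧ (∀ i, v i ∈ W)
  have hbound : ∀ E, P E → E ≤ Module.finrank K V := by
    rintro E ⟨u, v, h, -, -⟩
    have hli := h.linearIndependent_sumElim hω (c := (Empty.elim : Empty → V))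
      linearIndependent_empty_type (fun k => k.elim) (fun k => k.elim)
    have := hli.fintype_card_le_finrank
    simp at this
    omega
  have hzero : P 0 := ⟨Fin.elim0, Fin.elim0,
    ⟨fun i => i.elim0, fun i => i.elim0, fun i => i.elim0⟩, fun i => i.elim0, fun i => i.elim0⟩
  obtain ⟨E, ⟨u, v, h, hu, hv⟩, hmax⟩ : ∃ E, P E ∧ ¬ P (E + 1) := by
    by_contra! hcon
    have hall : ∀ E, P E := fun E => Nat.rec hzero (fun k hk => hcon k hk) E
    have := hbound _ (hall (Module.finrank K V + 1))
    omega
  refine ⟨E, u, v, h, hu, hv, fun w hw w' hw' => ?_⟩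
  by_contra hne
  set x := symplecticResidue ω u v w with hx
  have hxu : ∀ i, ω x (u i) = 0 := h.symplecticResidue_left hω w
  have hxv : ∀ i, ω x (v i) = 0 := h.symplecticResidue_right w
  set y := symplecticResidue ω u v w' with hy
  have hxy : ω x y = ω x w' := by
    simp [hy, symplecticResidue, hxu, hxv]
  refine hmax ⟨Fin.cons x u, Fin.cons ((ω x w')⁻¹ • y) v,
    h.cons hω (by simp [hxy, hne]) hxu hxv
      (fun i => by simp [hy, h.symplecticResidue_left hω])
      (fun i => by simp [hy, h.symplecticResidue_right]), ?_, ?_⟩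
  · exact Fin.cases (symplecticResidue_mem hu hv hw) hu
  · exact Fin.cases (W.smul_mem _ (symplecticResidue_mem hu hv hw')) hv

end AlternatingForm

/-- `stdSymp` as a bilinear form. -/
def stdSympForm (m : ℕ) : LinearMap.BilinForm ℝ (Fin (2 * m) → ℝ) :=
  LinearMap.mk₂ ℝ (stdSymp m)
    (fun v v' w => by
      simp only [stdSymp, ← Finset.sum_add_distrib, Pi.add_apply]
      exact Finset.sum_congr rfl fun i _ => by ring)
    (fun c v w => by
      simp only [stdSymp, smul_eq_mul, Finset.mul_sum, Pi.smul_apply]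
      exact Finset.sum_congr rfl fun i _ => by ring)
    (fun v w w' => by
      simp only [stdSymp, ← Finset.sum_add_distrib, Pi.add_apply]
      exact Finset.sum_congr rfl fun i _ => by ring)
    (fun c v w => by
      simp only [stdSymp, smul_eq_mul, Finset.mul_sum, Pi.smul_apply]
      exact Finset.sum_congr rfl fun i _ => by ring)

theorem stdSympForm_apply (m : ℕ) (v w : Fin (2 * m) → ℝ) :
    stdSympForm m v w = stdSymp m v w := rfl

theorem stdSympForm_isAlt (m : ℕ) : (stdSympForm m).IsAlt := fun v => by
  rw [stdSympForm_apply, stdSymp]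
  exact Finset.sum_eq_zero fun i _ => by ring

theorem eq_zero_of_stdSymp_eq_zero {m : ℕ} {v : Fin (2 * m) → ℝ}
    (h : ∀ w, stdSymp m v w = 0) : v = 0 := by
  have heven : ∀ i : Fin m, v ⟨2 * (i : ℕ), by have := i.isLt; omega⟩ = 0 := by
    intro i
    have hi := h (Pi.single ⟨2 * (i : ℕ) + 1, by have := i.isLt; omega⟩ 1)
    rw [stdSymp, Finset.sum_eq_single i] at hi
    · simpa [Pi.single_apply] using hi
    · intro j _ hj
      have hj' : (j : ℕ) ≠ i := fun e => hj (Fin.ext e)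
      have h1 : 2 * (j : ℕ) ≠ 2 * i + 1 := by omega
      simp [hj', h1]
    · simp
  have hodd : ∀ i : Fin m, v ⟨2 * (i : ℕ) + 1, by have := i.isLt; omega⟩ = 0 := by
    intro i
    have hi := h (Pi.single ⟨2 * (i : ℕ), by have := i.isLt; omega⟩ 1)
    rw [stdSymp, Finset.sum_eq_single i] at hi
    · simpa [Pi.single_apply] using hi
    · intro j _ hj
      have hj' : (j : ℕ) ≠ i := fun e => hj (Fin.ext e)
      have h1 : 2 * (j : ℕ) + 1 ≠ 2 * i := by omega
      simp [hj', h1]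
    · simp
  funext ⟨k, hk⟩
  obtain ⟨i, rfl | rfl⟩ := Nat.even_or_odd' k
  · exact heven ⟨i, by omega⟩
  · exact hodd ⟨i, by omega⟩

/-- `prodSymp` as a bilinear form. -/
def prodSympForm (nA nB : ℕ) :
    LinearMap.BilinForm ℝ ((Fin (2 * nA) → ℝ) × (Fin (2 * nB) → ℝ)) :=
  (stdSympForm nA).compl₁₂ (LinearMap.fst ℝ _ _) (LinearMap.fst ℝ _ _) +
    (stdSympForm nB).compl₁₂ (LinearMap.snd ℝ _ _) (LinearMap.snd ℝ _ _)

theorem prodSympForm_apply (nA nB : ℕ) (u w : (Fin (2 * nA) → ℝ) × (Fin (2 * nB) → ℝ)) :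
    prodSympForm nA nB u w = prodSymp nA nB u w := rfl

theorem prodSympForm_isAlt (nA nB : ℕ) : (prodSympForm nA nB).IsAlt := fun u => by
  rw [prodSympForm_apply, prodSymp, ← stdSympForm_apply, ← stdSympForm_apply,
    (stdSympForm_isAlt nA).self_eq_zero, (stdSympForm_isAlt nB).self_eq_zero, add_zero]

theorem prodSympForm_nondegenerate (nA nB : ℕ) : (prodSympForm nA nB).Nondegenerate := by
  refine (prodSympForm_isAlt nA nB).isRefl.nondegenerate_iff_separatingLeft.2 fun u hu => ?_
  refine Prod.ext (eq_zero_of_stdSymp_eq_zero fun w => ?_)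
    (eq_zero_of_stdSymp_eq_zero fun w => ?_)
  · have := hu (w, 0)
    rw [prodSympForm_apply, prodSymp, ← stdSympForm_apply nB, map_zero, add_zero] at this
    exact this
  · have := hu (0, w)
    rw [prodSympForm_apply, prodSymp, ← stdSympForm_apply nA, map_zero, zero_add] at this
    exact this

theorem orthogonal_eq_self_of_lagrangian {nA nB : ℕ}
    {L : Submodule ℝ ((Fin (2 * nA) → ℝ) × (Fin (2 * nB) → ℝ))}
    (hiso : ∀ u ∈ L, ∀ w ∈ L, prodSymp nA nB u w = 0)
    (hdim : Module.finrank ℝ L = nA + nB) :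
    (prodSympForm nA nB).orthogonal L = L := by
  symm
  apply Submodule.eq_of_le_of_finrank_eq
  · intro u hu
    rw [LinearMap.BilinForm.mem_orthogonal_iff]
    exact fun w hw => hiso w hw u hu
  · rw [LinearMap.BilinForm.finrank_orthogonal (prodSympForm_nondegenerate nA nB), hdim]
    simp
    omega

/-- **Canonical decomposition of a Lagrangian subspace of a product symplectic space.**
A Lagrangian `L ⊆ ℝ^(2nA) × ℝ^(2nB)` has a basis consisting of local vectors `(a_i, 0)`,
`(0, b_j)` and `E` correlated pairs `u_k = (u_k^A, u_k^B)`, `ū_k = (ū_k^A, ū_k^B)` with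
`σ_A(u_k^A, ū_{k'}^A) = -σ_B(u_k^B, ū_{k'}^B)`, nonzero exactly when `k = k'`, and with
the `A`-parts of the `u`'s (resp. of the `ū`'s) mutually `σ_A`-orthogonal. -/
theorem lagrangian_canonical_decomposition (nA nB : ℕ)
    (L : Submodule ℝ ((Fin (2 * nA) → ℝ) × (Fin (2 * nB) → ℝ)))
    (hiso : ∀ u ∈ L, ∀ w ∈ L, prodSymp nA nB u w = 0)
    (hdim : Module.finrank ℝ L = nA + nB) :
    ∃ (r s E : ℕ), r + s + 2 * E = nA + nB ∧
    ∃ (a : Fin r → (Fin (2 * nA) → ℝ)) (b : Fin s → (Fin (2 * nB) → ℝ))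
      (u ubar : Fin E → ((Fin (2 * nA) → ℝ) × (Fin (2 * nB) → ℝ))),
      LinearIndependent ℝ
        (Sum.elim (fun i => ((a i, 0) : (Fin (2 * nA) → ℝ) × (Fin (2 * nB) → ℝ)))
          (Sum.elim (fun j => ((0, b j) : (Fin (2 * nA) → ℝ) × (Fin (2 * nB) → ℝ)))
            (Sum.elim u ubar))) ∧
      Submodule.span ℝ
        (Set.range (Sum.elim (fun i => ((a i, 0) : (Fin (2 * nA) → ℝ) × (Fin (2 * nB) → ℝ)))
          (Sum.elim (fun j => ((0, b j) : (Fin (2 * nA) → ℝ) × (Fin (2 * nB) → ℝ)))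
            (Sum.elim u ubar)))) = L ∧
      (∀ k k' : Fin E, stdSymp nA (u k).1 (ubar k').1 = -stdSymp nB (u k).2 (ubar k').2) ∧
      (∀ k : Fin E, stdSymp nA (u k).1 (ubar k).1 ≠ 0) ∧
      (∀ k k' : Fin E, k ≠ k' → stdSymp nA (u k).1 (ubar k').1 = 0) ∧
      (∀ k k' : Fin E, stdSymp nA (u k).1 (u k').1 = 0) ∧
      (∀ k k' : Fin E, stdSymp nA (ubar k).1 (ubar k').1 = 0) := by
  let ω : LinearMap.BilinForm ℝ ((Fin (2 * nA) → ℝ) × (Fin (2 * nB) → ℝ)) :=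
    (stdSympForm nA).compl₁₂ (LinearMap.fst ℝ _ _) (LinearMap.fst ℝ _ _)
  have hω_apply : ∀ x y, ω x y = stdSymp nA x.1 y.1 := fun _ _ => rfl
  have hω : ω.IsAlt := fun x => (stdSympForm_isAlt nA).self_eq_zero x.1
  have hAB : ∀ x ∈ L, ∀ y ∈ L, stdSymp nA x.1 y.1 = -stdSymp nB x.2 y.2 :=
    fun x hx y hy => eq_neg_of_add_eq_zero_left (hiso x hx y hy)
  have hzeroA : ∀ w, stdSymp nA 0 w = 0 := fun w =>
    LinearMap.congr_fun (map_zero (stdSympForm nA)) w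
  have hzeroB : ∀ w, stdSymp nB 0 w = 0 := fun w =>
    LinearMap.congr_fun (map_zero (stdSympForm nB)) w
  have hzeroB' : ∀ w, stdSymp nB w 0 = 0 := fun w => map_zero (stdSympForm nB w)
  obtain ⟨E, u, v, huv, hu, hv, hres⟩ := exists_isSymplecticFamily_residue_mem_radical hω L
  let LA := L.comap (LinearMap.inl ℝ (Fin (2 * nA) → ℝ) (Fin (2 * nB) → ℝ))
  let LB := L.comap (LinearMap.inr ℝ (Fin (2 * nA) → ℝ) (Fin (2 * nB) → ℝ))
  let bA := Module.finBasis ℝ LA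
  let bB := Module.finBasis ℝ LB
  let a : Fin (Module.finrank ℝ LA) → (Fin (2 * nA) → ℝ) := fun i => bA i
  let b : Fin (Module.finrank ℝ LB) → (Fin (2 * nB) → ℝ) := fun i => bB i
  have haL : ∀ i, (a i, 0) ∈ L := fun i => (bA i).2
  have hbL : ∀ i, (0, b i) ∈ L := fun i => (bB i).2
  have ha : LinearIndependent ℝ a := bA.linearIndependent.map' LA.subtype LA.ker_subtype
  have hb : LinearIndependent ℝ b := bB.linearIndependent.map' LB.subtype LB.ker_subtype
  have hspanA : Submodule.span ℝ (Set.range a) = LA := by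
    have : Set.range a = LA.subtype '' Set.range bA := by rw [← Set.range_comp]; rfl
    rw [this, Submodule.span_image, bA.span_eq, Submodule.map_top, Submodule.range_subtype]
  have hspanB : Submodule.span ℝ (Set.range b) = LB := by
    have : Set.range b = LB.subtype '' Set.range bB := by rw [← Set.range_comp]; rfl
    rw [this, Submodule.span_image, bB.span_eq, Submodule.map_top, Submodule.range_subtype]
  have haω : ∀ i, ∀ y ∈ L, ω (a i, 0) y = 0 := fun i y hy => by
    rw [hω_apply, hAB _ (haL i) y hy, hzeroB, neg_zero]
  have hbω : ∀ i y, ω (0, b i) y = 0 := fun i y => hzeroA _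
  have hli : LinearIndependent ℝ
      (Sum.elim (fun i => ((a i, 0) : (Fin (2 * nA) → ℝ) × (Fin (2 * nB) → ℝ)))
        (Sum.elim (fun j => ((0, b j) : (Fin (2 * nA) → ℝ) × (Fin (2 * nB) → ℝ)))
          (Sum.elim u v))) := by
    have hc := linearIndependent_inl_union_inr' ha hb
    have h := huv.linearIndependent_sumElim hω hc
      (by rintro (i | i) k; exacts [haω i _ (hu k), hbω i _])
      (by rintro (i | i) k; exacts [haω i _ (hv k), hbω i _])
    have hassoc : Sum.elim (fun i => ((a i, 0) : (Fin (2 * nA) → ℝ) × (Fin (2 * nB) → ℝ)))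
        (Sum.elim (fun j => (0, b j)) (Sum.elim u v)) ∘ Equiv.sumAssoc _ _ _ =
        Sum.elim (Sum.elim (LinearMap.inl ℝ _ _ ∘ a) (LinearMap.inr ℝ _ _ ∘ b))
          (Sum.elim u v) := by
      ext1 ((i | i) | i | i) <;> rfl
    rw [← linearIndependent_equiv (Equiv.sumAssoc _ _ _), hassoc]
    exact h
  have hspan : Submodule.span ℝ (Set.range
      (Sum.elim (fun i => ((a i, 0) : (Fin (2 * nA) → ℝ) × (Fin (2 * nB) → ℝ)))
        (Sum.elim (fun j => ((0, b j) : (Fin (2 * nA) → ℝ) × (Fin (2 * nB) → ℝ)))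
          (Sum.elim u v)))) = L := by
    apply le_antisymm
    · rw [Submodule.span_le]
      rintro _ ⟨i | i | i | i, rfl⟩
      exacts [haL i, hbL i, hu i, hv i]
    · intro w hw
      set S := Submodule.span ℝ (Set.range
        (Sum.elim (fun i => ((a i, 0) : (Fin (2 * nA) → ℝ) × (Fin (2 * nB) → ℝ)))
          (Sum.elim (fun j => ((0, b j) : (Fin (2 * nA) → ℝ) × (Fin (2 * nB) → ℝ)))
            (Sum.elim u v))))
      have huS : ∀ i, u i ∈ S := fun i => Submodule.subset_span ⟨.inr (.inr (.inl i)), rfl⟩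
      have hvS : ∀ i, v i ∈ S := fun i => Submodule.subset_span ⟨.inr (.inr (.inr i)), rfl⟩
      have hAS : LA ≤ S.comap (LinearMap.inl ℝ _ _) := by
        rw [← hspanA, Submodule.span_le]
        rintro _ ⟨i, rfl⟩
        exact Submodule.subset_span ⟨.inl i, rfl⟩
      have hBS : LB ≤ S.comap (LinearMap.inr ℝ _ _) := by
        rw [← hspanB, Submodule.span_le]
        rintro _ ⟨i, rfl⟩
        exact Submodule.subset_span ⟨.inr (.inl i), rfl⟩
      set z := symplecticResidue ω u v w with hz
      have hzL : z ∈ L := symplecticResidue_mem hu hv hw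
      have hz1 : (z.1, 0) ∈ L := by
        rw [← orthogonal_eq_self_of_lagrangian hiso hdim, LinearMap.BilinForm.mem_orthogonal_iff]
        intro y hy
        change stdSymp nA y.1 z.1 + stdSymp nB y.2 0 = 0
        rw [hzeroB', add_zero]
        exact hω.isRefl z y (hres w hw y hy)
      have hz2 : (0, z.2) ∈ L := by
        have := L.sub_mem hzL hz1
        rwa [show z - (z.1, 0) = (0, z.2) by ext <;> simp] at this
      have hzS : z ∈ S := by
        have := S.add_mem (hAS (show z.1 ∈ LA from hz1)) (hBS (show z.2 ∈ LB from hz2))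
        simpa using this
      have hw_eq : w = z + (∑ i, ω w (v i) • u i - ∑ i, ω w (u i) • v i) := by
        rw [hz, symplecticResidue, sub_add_cancel]
      rw [hw_eq]
      exact S.add_mem hzS (S.sub_mem (S.sum_mem fun i _ => S.smul_mem _ (huS i))
        (S.sum_mem fun i _ => S.smul_mem _ (hvS i)))
  refine ⟨Module.finrank ℝ LA, Module.finrank ℝ LB, E, ?_, a, b, u, v, hli, hspan,
    fun k k' => hAB _ (hu k) _ (hv k'), fun k => ?_, fun k k' hkk' => ?_,
    huv.left_left, huv.right_right⟩
  · have hcard := finrank_span_eq_card hli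
    rw [hspan, hdim] at hcard
    simp only [Fintype.card_sum, Fintype.card_fin] at hcard
    omega
  · rw [← hω_apply, huv.left_right, if_pos rfl]
    exact one_ne_zero
  · rw [← hω_apply, huv.left_right, if_neg hkk']

end EntTrim
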